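/- The map t ↦ Φ_t^{231} is a bijection from the set 𝔗_{n+1} of rooted ordered trees with n+1 vertices to the set Av_n(231) of permutations of [n] avoiding 231, where for t ∈ 𝔗_{n+1} with vertices v_0, v_1, …, v_n listed in increasing lexicographic order (v_0 = ∅ the root), Φ_t^{231}(i) = i + |t_{v_i}| − |v_i| for i = 1, …, n, with t_{v_i} the fringe subtree of t at v_i and |v_i| the height of v_i. (Here Φ_t^{231} is to be verified to be a permutation of [n] avoiding 231, and the map is injective and surjective onto Av_n(231).) -/

import Mathlib

open Set Filter MeasureTheory Topology TopologicalSpace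
open scoped ENNReal

namespace AvoidPaper

/-- Instances for the codomain `ℕ∞` (one-point compactification of `ℕ`). -/
instance : SecondCountableTopology ℕ∞ := by
  have h : ({s : Set ℕ∞ | ∃ a, s = Set.Ioi a ∨ s = Set.Iio a}).Countable := by
    have hsub : {s : Set ℕ∞ | ∃ a, s = Set.Ioi a ∨ s = Set.Iio a}
        ⊆ Set.range (Set.Ioi : ℕ∞ → Set ℕ∞) ∪ Set.range (Set.Iio : ℕ∞ → Set ℕ∞) := by
      rintro s ⟨a, rfl | rfl⟩
      · exact Or.inl ⟨a, rfl⟩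
      · exact Or.inr ⟨a, rfl⟩
    exact ((Set.countable_range _).union (Set.countable_range _)).mono hsub
  exact SecondCountableTopology.mk' h

instance : OpensMeasurableSpace ℕ∞ := ⟨le_top⟩

/-! ## Ulam–Harris vertices and rooted ordered trees -/

/-- A vertex of the Ulam–Harris tree: a finite list of natural numbers (children indices),
ordered lexicographically (so an ancestor precedes its descendants). -/
abbrev Vertex : Type := List ℕ

/-- A (rooted ordered) tree: contains the root, is closed under ancestors, and is
left-closed among siblings. -/
def IsTree (t : Set Vertex) : Prop :=
  ([] : Vertex) ∈ t ∧ (∀ u v : Vertex, u ++ v ∈ t → u ∈ t) ∧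
    ∀ (u : Vertex) (i j : ℕ), u ++ [i] ∈ t → j ≤ i → u ++ [j] ∈ t

/-- The set of children indices of `u` in `t`. -/
def children (t : Set Vertex) (u : Vertex) : Set ℕ := {i | u ++ [i] ∈ t}

/-- Locally finite tree. -/
def LocFin (t : Set Vertex) : Prop := ∀ u : Vertex, (children t u).Finite

/-- Number of children of `u` in `t`. -/
noncomputable def childCount (t : Set Vertex) (u : Vertex) : ℕ := (children t u).ncard

/-- The degree function `d_t(u)`: number of children, and `-1` if `u ∉ t`. -/
noncomputable def deg (t : Set Vertex) (u : Vertex) : ℤ :=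
  haveI := Classical.dec (u ∈ t)
  if u ∈ t then (childCount t u : ℤ) else -1

/-- `t^[m]`: restriction of `t` to the vertices of height at most `m`. -/
def trunc (t : Set Vertex) (m : ℕ) : Set Vertex := {u ∈ t | u.length ≤ m}

/-- Local convergence of trees: `d_{t_n}(u) → d_t(u)` for every vertex `u`
(equivalently, eventual equality, since degrees are integers). -/
def LocalConv (ts : ℕ → Set Vertex) (t : Set Vertex) : Prop :=
  ∀ u : Vertex, ∀ᶠ n in atTop, deg (ts n) u = deg t u

/-- A leaf: a vertex of `t` with no children. -/
def IsLeaf (t : Set Vertex) (v : Vertex) : Prop := v ∈ t ∧ ∀ i : ℕ, v ++ [i] ∉ t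

def leafSet (t : Set Vertex) : Set Vertex := {v | IsLeaf t v}

/-- The fringe subtree `t_v` of `t` at `v` (as a subset of `t`). -/
def fringe (t : Set Vertex) (v : Vertex) : Set Vertex := {x ∈ t | v <+: x}

/-- Number of vertices of `t` at height exactly `k`. -/
noncomputable def levelCount (t : Set Vertex) (k : ℕ) : ℕ := {u ∈ t | u.length = k}.ncard

/-- An infinite spine of `t`: `η 0` is the root and `η (i+1)` is a child of `η i`. -/
def IsSpine (t : Set Vertex) (η : ℕ → Vertex) : Prop :=
  η 0 = [] ∧ (∀ i, η i ∈ t) ∧ ∀ i, ∃ c : ℕ, η (i + 1) = η i ++ [c]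

/-- `v` lies strictly to the left of the spine `η`. -/
def LeftOfSpine (t : Set Vertex) (η : ℕ → Vertex) (v : Vertex) : Prop :=
  v ∈ t ∧ (∀ i, η i ≠ v) ∧ ∃ j, v < η j

/-- `v` lies strictly to the right of the spine `η`. -/
def RightOfSpine (t : Set Vertex) (η : ℕ → Vertex) (v : Vertex) : Prop :=
  v ∈ t ∧ ∀ j, η j < v

/-- `η` is the unique infinite spine of `t`, with infinitely many subtrees attached to
the left and to the right of the spine, infinitely many of the left ones having at
least two vertices. -/
def SpineSpec (t : Set Vertex) (η : ℕ → Vertex) : Prop :=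
  IsSpine t η ∧ (∀ η', IsSpine t η' → η' = η) ∧
  {u : Vertex | (∃ k c, u = η k ++ [c]) ∧ LeftOfSpine t η u}.Infinite ∧
  {u : Vertex | (∃ k c, u = η k ++ [c]) ∧ RightOfSpine t η u}.Infinite ∧
  {u : Vertex | (∃ k c, u = η k ++ [c]) ∧ LeftOfSpine t η u ∧
      2 ≤ (fringe t u).encard}.Infinite

/-- `𝔗_f`: finite trees with at least two vertices. -/
def MemTf (t : Set Vertex) : Prop := IsTree t ∧ t.Finite ∧ 2 ≤ t.encard

/-- `𝔗_∞`. -/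
def MemTinf (t : Set Vertex) : Prop :=
  IsTree t ∧ LocFin t ∧ t.Infinite ∧ ∃ η : ℕ → Vertex, SpineSpec t η

/-- The leaves of `t` lying to the left of the spine `η`. -/
def leftLeaves (t : Set Vertex) (η : ℕ → Vertex) : Set Vertex :=
  {x | IsLeaf t x ∧ LeftOfSpine t η x}

/-- `v` is the enumeration `(v_{t,i})` of (an initial part of) `t` in increasing
lexicographic order: `v i ∈ t` and the vertices of `t` smaller than `v i` are
exactly `v 0, …, v (i-1)`. -/
def IsLexEnum (t : Set Vertex) (v : ℕ → Vertex) : Prop :=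
  ∀ i : ℕ, (i : ℕ∞) < t.encard →
    v i ∈ t ∧ {x ∈ t | x < v i} = v '' {j | j < i}

/-- `w` is the enumeration `(w_{t,i})` of (a final part of) `t` in decreasing
lexicographic order, starting from the lexicographically largest vertex. -/
def IsLexCoEnum (t : Set Vertex) (w : ℕ → Vertex) : Prop :=
  ∀ i : ℕ, (i : ℕ∞) < t.encard →
    w i ∈ t ∧ {x ∈ t | w i < x} = w '' {j | j < i}

/-- `l` enumerates the set `A` in increasing lexicographic order. -/
def IsEnumOf (A : Set Vertex) (l : ℕ → Vertex) : Prop :=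
  ∀ i : ℕ, (i : ℕ∞) < A.encard →
    l i ∈ A ∧ {x ∈ A | x < l i} = l '' {j | j < i}

/-- `s_i`: the number of vertices of `t` lexicographically smaller than the `i`-th leaf
(0-indexed: `l 0` is the paper's `l_1`). -/
noncomputable def sVal (t : Set Vertex) (l : ℕ → Vertex) (i : ℕ) : ℕ :=
  {x ∈ t | x < l i}.ncard

/-- `p_i`: the height of the `i`-th leaf. -/
def pVal (l : ℕ → Vertex) (i : ℕ) : ℕ := (l i).length

/-! ## The maps Φ^σ -/

/-- `Φ^{231}` as an element of `F(ℕ, ℕ*)` (value `i` outside the range of indices). -/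
noncomputable def phi231 (t : Set Vertex) (v : ℕ → Vertex) : ℕ → ℕ∞ := fun i =>
  if 1 ≤ i ∧ (i : ℕ∞) < t.encard then
    ((i : ℕ∞) + (fringe t (v i)).encard) - ((v i).length : ℕ∞)
  else (i : ℕ∞)

noncomputable def phi213 (t : Set Vertex) (v : ℕ → Vertex) : ℕ → ℕ∞ := fun i =>
  if 1 ≤ i ∧ (i : ℕ∞) < t.encard then
    ((t \ fringe t (v i)).encard + ((v i).length : ℕ∞)) - (i : ℕ∞)
  else (i : ℕ∞)

noncomputable def phi312 (t : Set Vertex) (w : ℕ → Vertex) : ℕ → ℕ∞ := fun i =>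
  if 1 ≤ i ∧ (i : ℕ∞) < t.encard then
    ((i : ℕ∞) + ((w (i - 1)).length : ℕ∞)) - (fringe t (w (i - 1))).encard
  else (i : ℕ∞)

noncomputable def phi132 (t : Set Vertex) (w : ℕ → Vertex) : ℕ → ℕ∞ := fun i =>
  if 1 ≤ i ∧ (i : ℕ∞) < t.encard then
    ((t.encard + (fringe t (w (i - 1))).encard) - (i : ℕ∞)) - ((w (i - 1)).length : ℕ∞)
  else (i : ℕ∞)

/-- `B = {s_i - p_i + 1 : i}` (with `i` ranging over indices `< L` of leaves). -/
def Bset (S P : ℕ → ℕ) (L : ℕ∞) : Set ℕ :=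
  {b | ∃ i : ℕ, (i : ℕ∞) < L ∧ S i - P i + 1 = b}

/-- `A = {s_i : i}`. -/
def Aset (S : ℕ → ℕ) (L : ℕ∞) : Set ℕ := {a | ∃ i : ℕ, (i : ℕ∞) < L ∧ S i = a}

/-- The number of elements of `C` in `{1, …, j}`. -/
noncomputable def rankIn (C : Set ℕ) (j : ℕ) : ℕ := (C ∩ Set.Icc 1 j).ncard

/-- The `a`-th smallest positive element of `C`. -/
noncomputable def nthOf (C : Set ℕ) (a : ℕ) : ℕ :=
  sInf {m : ℕ | a ≤ (C ∩ Set.Icc 1 m).ncard}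

open Classical in
/-- `Φ^{321}` built from the data `s, p` (and the number `L` of leaves):
`s_i - p_i + 1 ↦ s_i`, extended by the unique increasing bijection between the
complements (and by the identity outside `[1, n]` in the finite case). -/
noncomputable def phi321Fun (S P : ℕ → ℕ) (L : ℕ∞) : ℕ → ℕ∞ := fun j =>
  if h : j ∈ Bset S P L then (S h.choose : ℕ∞)
  else (nthOf (Aset S L)ᶜ (rankIn (Bset S P L)ᶜ j) : ℕ∞)

/-- `Φ^{123} = |t| + 1 - Φ^{321}` as an element of `F(ℕ, ℕ*)`. -/
noncomputable def phi123Fun (tc : ℕ∞) (f : ℕ → ℕ∞) : ℕ → ℕ∞ := fun j =>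
  if 1 ≤ j ∧ (j : ℕ∞) < tc then (tc + 1) - f j else (j : ℕ∞)

/-! ## Patterns and pattern avoidance -/

def p123 : Equiv.Perm (Fin 3) := Equiv.refl _
noncomputable def p321 : Equiv.Perm (Fin 3) := Equiv.ofBijective ![2, 1, 0] (by decide)
noncomputable def p231 : Equiv.Perm (Fin 3) := Equiv.ofBijective ![1, 2, 0] (by decide)
noncomputable def p213 : Equiv.Perm (Fin 3) := Equiv.ofBijective ![1, 0, 2] (by decide)
noncomputable def p312 : Equiv.Perm (Fin 3) := Equiv.ofBijective ![2, 0, 1] (by decide)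
noncomputable def p132 : Equiv.Perm (Fin 3) := Equiv.ofBijective ![0, 2, 1] (by decide)

/-- `π` contains the length-3 pattern `σ`. -/
def ContainsPat {n : ℕ} (π : Equiv.Perm (Fin n)) (σ : Equiv.Perm (Fin 3)) : Prop :=
  ∃ f : Fin 3 → Fin n, StrictMono f ∧ ∀ j k : Fin 3, σ j < σ k ↔ π (f j) < π (f k)

/-- `π` avoids the length-3 pattern `σ`. -/
def AvoidsPat {n : ℕ} (π : Equiv.Perm (Fin n)) (σ : Equiv.Perm (Fin 3)) : Prop :=
  ¬ ContainsPat π σ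

/-- Trees with `n+1` vertices. -/
def TreeN (n : ℕ) : Type := {t : Set Vertex // IsTree t ∧ t.encard = (n : ℕ∞) + 1}

/-- Embedding of a permutation of `[n]` into `F(ℕ, ℕ*)` by `π(k) = k` for `k > n`
(permutations are `1`-indexed: position `k ∈ [1, n]` corresponds to `k - 1 : Fin n`). -/
noncomputable def embedPerm {n : ℕ} (π : Equiv.Perm (Fin n)) : ℕ → ℕ∞ := fun k =>
  if h : 1 ≤ k ∧ k ≤ n then (((π ⟨k - 1, by omega⟩ : Fin n) : ℕ) + 1 : ℕ) else (k : ℕ∞)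

/-- The (finite) set of permutations of `[n]` avoiding `σ`. -/
noncomputable def avoidFinset (σ : Equiv.Perm (Fin 3)) (n : ℕ) : Finset (Equiv.Perm (Fin n)) :=
  Set.Finite.toFinset (Set.toFinite {π : Equiv.Perm (Fin n) | AvoidsPat π σ})

/-- The law of a uniformly random `σ`-avoiding permutation of `[n]`,
as a measure on `F(ℕ, ℕ*)`. -/
noncomputable def uniformAvoidLaw (σ : Equiv.Perm (Fin 3)) (n : ℕ) : Measure (ℕ → ℕ∞) :=
  ((avoidFinset σ n).card : ℝ≥0∞)⁻¹ • ∑ π ∈ avoidFinset σ n, Measure.dirac (embedPerm π)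


open Classical in
/-- `Φ^σ` for an arbitrary pattern `σ ∈ S_3`, given a tree together with its increasing
vertex enumeration `v`, its decreasing vertex enumeration `w`, and the increasing
enumeration `l` of the relevant set `Lset` of leaves. -/
noncomputable def PhiOf (σ : Equiv.Perm (Fin 3)) (t : Set Vertex)
    (v w l : ℕ → Vertex) (Lset : Set Vertex) : ℕ → ℕ∞ :=
  if σ = p231 then phi231 t v
  else if σ = p213 then phi213 t v
  else if σ = p312 then phi312 t w
  else if σ = p132 then phi132 t w
  else if σ = p321 then phi321Fun (sVal t l) (pVal l) Lset.encard
  else phi123Fun t.encard (phi321Fun (sVal t l) (pVal l) Lset.encard)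

open Classical in
noncomputable def canonSpine (t : Set Vertex) : ℕ → Vertex :=
  if h : ∃ η : ℕ → Vertex, IsSpine t η then h.choose else fun _ => []

open Classical in
noncomputable def canonV (t : Set Vertex) : ℕ → Vertex :=
  if h : ∃ v : ℕ → Vertex, IsLexEnum t v then h.choose else fun _ => []

open Classical in
noncomputable def canonW (t : Set Vertex) : ℕ → Vertex :=
  if h : ∃ w : ℕ → Vertex, IsLexCoEnum t w then h.choose else fun _ => []

open Classical in
noncomputable def canonL (t : Set Vertex) : ℕ → Vertex :=
  if h : ∃ l : ℕ → Vertex, IsEnumOf (leftLeaves t (canonSpine t)) l then h.choose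
  else fun _ => []

/-- `Φ^σ_t` for an infinite tree `t ∈ 𝔗_∞`, using the canonical (unique) spine and
enumerations. -/
noncomputable def PhiCanon (σ : Equiv.Perm (Fin 3)) (t : Set Vertex) : ℕ → ℕ∞ :=
  PhiOf σ t (canonV t) (canonW t) (canonL t) (leftLeaves t (canonSpine t))

/-- σ-algebra on the space of trees: all sets are measurable. -/
instance : MeasurableSpace (Set Vertex) := ⊤

/-- `μ` is the law of a Galton–Watson tree with offspring distribution `ξ`:
a probability measure, supported on trees, giving each finite tree `t` the
probability `∏_{u ∈ t} ξ(d_t(u))`. -/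
def IsGW (ξ : ℕ → ℝ≥0∞) (μ : Measure (Set Vertex)) : Prop :=
  IsProbabilityMeasure μ ∧ μ {t | IsTree t} = 1 ∧
    ∀ t : Set Vertex, IsTree t → ∀ ht : t.Finite,
      μ {t} = ∏ u ∈ ht.toFinset, ξ (childCount t u)

/-- `π` is the permutation `Φ^{321}_t` of `[n]` associated to a finite tree `t` with
`n+1` vertices: for every leaf `v` with `s = #{x ∈ t : x < v}` and `p = |v|`, position
`s - p + 1` is mapped to `s` (in 0-indexed form: position `s - p` to value `s - 1`),
and `π` is increasing on the remaining positions. -/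
def Is321Image (n : ℕ) (t : Set Vertex) (π : Equiv.Perm (Fin n)) : Prop :=
  (∀ v : Vertex, IsLeaf t v →
    ∃ hb : {x ∈ t | x < v}.ncard - v.length < n,
      ((π ⟨{x ∈ t | x < v}.ncard - v.length, hb⟩ : Fin n) : ℕ)
        = {x ∈ t | x < v}.ncard - 1) ∧
  ∀ a b : Fin n, a < b →
    (∀ v : Vertex, IsLeaf t v → {x ∈ t | x < v}.ncard - v.length ≠ (a : ℕ)) →
    (∀ v : Vertex, IsLeaf t v → {x ∈ t | x < v}.ncard - v.length ≠ (b : ℕ)) →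
    π a < π b

/-- `π` is the permutation `Φ^{123}_t = (n+1) - Φ^{321}_t` of `[n]`. -/
def Is123Image (n : ℕ) (t : Set Vertex) (π : Equiv.Perm (Fin n)) : Prop :=
  ∃ π' : Equiv.Perm (Fin n), Is321Image n t π' ∧ ∀ i : Fin n, π i = Fin.rev (π' i)


/-! ### The lexicographic order and the prefix order on vertices -/

/-- `x` branches off to the left of `y` at a common ancestor. -/
def IsLeftOf (x y : Vertex) : Prop :=
  ∃ (p : Vertex) (a b : ℕ), a < b ∧ p ++ [a] <+: x ∧ p ++ [b] <+: y

theorem IsLeftOf.mono {x y x' y' : Vertex} (h : IsLeftOf x y) (hx : x <+: x') (hy : y <+: y') :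
    IsLeftOf x' y' := by
  obtain ⟨p, a, b, hab, h1, h2⟩ := h
  exact ⟨p, a, b, hab, h1.trans hx, h2.trans hy⟩

theorem isLeftOf_cons_cons {a b : ℕ} {x y : Vertex} :
    IsLeftOf (a :: x) (b :: y) ↔ a < b ∨ (a = b ∧ IsLeftOf x y) := by
  constructor
  · rintro ⟨p, c, d, hcd, h1, h2⟩
    cases p with
    | nil =>
      simp only [List.nil_append, List.cons_prefix_cons] at h1 h2
      left; omega
    | cons e p =>
      simp only [List.cons_append, List.cons_prefix_cons] at h1 h2
      exact Or.inr ⟨h1.1.symm.trans h2.1, p, c, d, hcd, h1.2, h2.2⟩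
  · rintro (h | ⟨rfl, p, c, d, hcd, h1, h2⟩)
    · exact ⟨[], a, b, h, by simp, by simp⟩
    · exact ⟨a :: p, c, d, hcd, by simpa using h1, by simpa using h2⟩

theorem vertex_lt_iff {x y : Vertex} : x < y ↔ (x <+: y ∧ x ≠ y) ∨ IsLeftOf x y := by
  induction x generalizing y with
  | nil =>
    cases y with
    | nil =>
      simp [IsLeftOf]
    | cons b y => simp
  | cons a x ih =>
    cases y with
    | nil => simp [IsLeftOf]
    | cons b y =>
      rw [List.cons_lt_cons_iff, isLeftOf_cons_cons, ih, List.cons_prefix_cons]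
      simp only [ne_eq, List.cons.injEq]
      tauto

theorem IsLeftOf.lt {x y : Vertex} (h : IsLeftOf x y) : x < y := vertex_lt_iff.2 (Or.inr h)

theorem IsLeftOf.not_isPrefix {x y : Vertex} (h : IsLeftOf x y) : ¬ x <+: y :=
  fun hp => lt_irrefl _ (h.mono hp List.prefix_rfl).lt

theorem IsLeftOf.not_isPrefix_symm {x y : Vertex} (h : IsLeftOf x y) : ¬ y <+: x :=
  fun hp => lt_irrefl _ (h.mono List.prefix_rfl hp).lt

theorem isPrefix_or_isPrefix {x y z : Vertex} (hx : x <+: z) (hy : y <+: z) :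
    x <+: y ∨ y <+: x :=
  (le_total x.length y.length).imp (List.prefix_of_prefix_length_le hx hy)
    (List.prefix_of_prefix_length_le hy hx)

theorem prefix_antisymm {x y : Vertex} (h : x <+: y) (h' : y <+: x) : x = y :=
  h.eq_of_length_le h'.length_le

theorem le_of_isPrefix {x y : Vertex} (h : x <+: y) : x ≤ y := by
  by_cases hxy : x = y
  · exact hxy.le
  · exact (vertex_lt_iff.2 (Or.inl ⟨h, hxy⟩)).le

/-! ### The post-order -/

/-- `x` is at most `u` for the post-order, in which descendants precede their ancestors. -/
def PostLE (x u : Vertex) : Prop := u <+: x ∨ IsLeftOf x u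

theorem PostLE.trans {x u v : Vertex} (h : PostLE x u) (h' : PostLE u v) : PostLE x v := by
  rcases h with h | h <;> rcases h' with h' | h'
  · exact Or.inl (h'.trans h)
  · exact Or.inr (h'.mono h List.prefix_rfl)
  · obtain ⟨p, a, b, hab, h1, h2⟩ := h
    rcases isPrefix_or_isPrefix h2 h' with h3 | h3
    · exact Or.inr ⟨p, a, b, hab, h1, h3⟩
    · rcases List.prefix_concat_iff.1 h3 with rfl | h3
      · exact Or.inr ⟨p, a, b, hab, h1, List.prefix_rfl⟩
      · exact Or.inl (h3.trans ((List.prefix_append _ _).trans h1))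
  · rcases vertex_lt_iff.1 (h.lt.trans h'.lt) with ⟨h3, -⟩ | h3
    · exact absurd (h'.lt.trans (h.mono h3 List.prefix_rfl).lt) (lt_irrefl _)
    · exact Or.inr h3

theorem PostLE.antisymm {x u : Vertex} (h : PostLE x u) (h' : PostLE u x) : x = u := by
  rcases h with h | h <;> rcases h' with h' | h'
  · exact prefix_antisymm h' h
  · exact absurd h h'.not_isPrefix
  · exact absurd h' h.not_isPrefix
  · exact absurd (h.lt.trans h'.lt) (lt_irrefl _)

theorem postLE_of_lt {x y : Vertex} (h : x < y) : PostLE x y ↔ ¬ x <+: y := by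
  rcases vertex_lt_iff.1 h with ⟨h1, h2⟩ | h1
  · refine iff_of_false (fun h3 => h2 ?_) (not_not.2 h1)
    exact h3.antisymm (Or.inl h1)
  · exact iff_of_true (Or.inr h1) h1.not_isPrefix

/-- The number of vertices of `t` that are at most `u` for the post-order. -/
noncomputable def postRank (t : Set Vertex) (u : Vertex) : ℕ := {x ∈ t | PostLE x u}.ncard

theorem postRank_lt {t : Set Vertex} (ht : t.Finite) {x u : Vertex} (hu : u ∈ t) (hxu : x ≠ u)
    (h : PostLE x u) : postRank t x < postRank t u := by
  refine Set.ncard_lt_ncard ⟨fun z hz => ⟨hz.1, hz.2.trans h⟩, fun hsub => hxu ?_⟩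
    (ht.subset (Set.sep_subset _ _))
  exact h.antisymm (hsub ⟨hu, Or.inl List.prefix_rfl⟩ : u ∈ t ∧ PostLE u x).2

theorem postRank_lt_iff {t : Set Vertex} (ht : t.Finite) {x y : Vertex} (hx : x ∈ t) (hy : y ∈ t)
    (h : x < y) : postRank t y < postRank t x ↔ x <+: y := by
  by_cases hp : x <+: y
  · exact iff_of_true (postRank_lt ht hx h.ne' (Or.inl hp)) hp
  · exact iff_of_false (postRank_lt ht hy h.ne ((postLE_of_lt h).2 hp)).not_gt hp

theorem postRank_pos {t : Set Vertex} (ht : t.Finite) {u : Vertex} (hu : u ∈ t) :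
    0 < postRank t u :=
  (Set.ncard_pos (ht.subset (Set.sep_subset _ _))).2 ⟨u, hu, Or.inl List.prefix_rfl⟩

theorem ncard_strict_prefixes (u : Vertex) : {x | x <+: u ∧ x ≠ u}.ncard = u.length := by
  have : {x | x <+: u ∧ x ≠ u} = (fun k => u.take k) '' (Finset.range u.length : Set ℕ) := by
    ext x
    simp only [Set.mem_ofPred_eq, Set.mem_image, Finset.mem_coe, Finset.mem_range]
    constructor
    · rintro ⟨h1, h2⟩
      refine ⟨x.length, ?_, (List.prefix_iff_eq_take.1 h1).symm⟩
      exact lt_of_le_of_ne h1.length_le fun h => h2 (h1.eq_of_length h)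
    · rintro ⟨k, hk, rfl⟩
      refine ⟨⟨_, List.take_append_drop k u⟩, fun h => ?_⟩
      have := congrArg List.length h
      simp at this
      omega
  rw [this, Set.InjOn.ncard_image, Set.ncard_coe_finset, Finset.card_range]
  intro a ha b hb hab
  have := congrArg List.length hab
  simp only [Finset.coe_range, Set.mem_Iio] at ha hb
  simp at this
  omega

theorem postRank_add_length {t : Set Vertex} (hT : IsTree t) (ht : t.Finite) {u : Vertex}
    (hu : u ∈ t) :
    postRank t u + u.length = {x ∈ t | x < u}.ncard + (fringe t u).ncard := by
  have fin (P : Vertex → Prop) : {x ∈ t | P x}.Finite := ht.subset (Set.sep_subset _ _)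
  have hproper : {x ∈ t | x <+: u ∧ x ≠ u} = {x | x <+: u ∧ x ≠ u} := by
    ext x
    refine ⟨fun h => h.2, fun h => ⟨?_, h⟩⟩
    obtain ⟨v, hv⟩ := h.1
    exact hT.2.1 x v (hv ▸ hu)
  have h1 : {x ∈ t | PostLE x u} = fringe t u ∪ {x ∈ t | IsLeftOf x u} := by
    ext x; simp only [PostLE, fringe, Set.mem_union, Set.mem_ofPred_eq]; tauto
  have h2 : {x ∈ t | x < u} = {x ∈ t | x <+: u ∧ x ≠ u} ∪ {x ∈ t | IsLeftOf x u} := by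
    ext x; simp only [vertex_lt_iff, Set.mem_union, Set.mem_ofPred_eq]; tauto
  have d1 : Disjoint (fringe t u) {x ∈ t | IsLeftOf x u} :=
    Set.disjoint_left.2 fun x hx hx' => hx'.2.not_isPrefix_symm hx.2
  have d2 : Disjoint {x ∈ t | x <+: u ∧ x ≠ u} {x ∈ t | IsLeftOf x u} :=
    Set.disjoint_left.2 fun x hx hx' => hx'.2.not_isPrefix hx.2.1
  rw [postRank, h1, h2, Set.ncard_union_eq d1 (ht.subset (Set.sep_subset _ _)) (fin _),
    Set.ncard_union_eq d2 (fin _) (fin _), hproper, ncard_strict_prefixes]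
  omega

/-! ### Lexicographic enumerations -/

theorem natCast_lt_add_one_iff {i n : ℕ} : (i : ℕ∞) < (n : ℕ∞) + 1 ↔ i ≤ n := by
  norm_cast; omega

theorem finite_of_encard {t : Set Vertex} {n : ℕ} (hn : t.encard = (n : ℕ∞) + 1) : t.Finite :=
  Set.finite_of_encard_eq_coe (k := n + 1) (by simpa using hn)

theorem IsLexEnum.lt {t : Set Vertex} {n : ℕ} {v : ℕ → Vertex} (hv : IsLexEnum t v)
    (hn : t.encard = (n : ℕ∞) + 1) {i j : ℕ} (hij : i < j) (hj : j ≤ n) : v i < v j := by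
  have := (hv j (by rwa [hn, natCast_lt_add_one_iff])).2
  exact (this.symm ▸ Set.mem_image_of_mem v hij : v i ∈ {x ∈ t | x < v j}).2

theorem IsLexEnum.mem {t : Set Vertex} {n : ℕ} {v : ℕ → Vertex} (hv : IsLexEnum t v)
    (hn : t.encard = (n : ℕ∞) + 1) {i : ℕ} (hi : i ≤ n) : v i ∈ t :=
  (hv i (by rwa [hn, natCast_lt_add_one_iff])).1

theorem IsLexEnum.exists_of_lt {t : Set Vertex} {n : ℕ} {v : ℕ → Vertex} (hv : IsLexEnum t v)
    (hn : t.encard = (n : ℕ∞) + 1) {i : ℕ} (hi : i ≤ n) {x : Vertex} (hx : x ∈ t)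
    (hxi : x < v i) : ∃ j < i, v j = x := by
  have := (hv i (by rwa [hn, natCast_lt_add_one_iff])).2
  exact (this ▸ ⟨hx, hxi⟩ : x ∈ v '' {j | j < i})

theorem IsLexEnum.injOn {t : Set Vertex} {n : ℕ} {v : ℕ → Vertex} (hv : IsLexEnum t v)
    (hn : t.encard = (n : ℕ∞) + 1) : Set.InjOn v (Set.Iic n) :=
  StrictMonoOn.injOn fun _ _ _ hj hij => hv.lt hn hij hj

theorem encard_image_Iic {n : ℕ} {v : ℕ → Vertex} (hv : Set.InjOn v (Set.Iic n)) :
    (v '' Set.Iic n).encard = (n : ℕ∞) + 1 := by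
  rw [hv.encard_image, ← Finset.coe_Iic, Set.encard_coe_eq_coe_finsetCard, Nat.card_Iic]
  push_cast; rfl

theorem IsLexEnum.image_eq {t : Set Vertex} {n : ℕ} {v : ℕ → Vertex} (hv : IsLexEnum t v)
    (hn : t.encard = (n : ℕ∞) + 1) : v '' Set.Iic n = t := by
  refine (finite_of_encard hn).eq_of_subset_of_encard_le' ?_ ?_
  · rintro _ ⟨i, hi, rfl⟩
    exact hv.mem hn hi
  · rw [hn, encard_image_Iic (hv.injOn hn)]

theorem isLexEnum_of_strictMonoOn {n : ℕ} {v : ℕ → Vertex} (hv : StrictMonoOn v (Set.Iic n)) :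
    IsLexEnum (v '' Set.Iic n) v := by
  intro i hi
  rw [encard_image_Iic hv.injOn, natCast_lt_add_one_iff] at hi
  refine ⟨Set.mem_image_of_mem v hi, ?_⟩
  ext x
  constructor
  · rintro ⟨⟨j, hj, rfl⟩, hlt⟩
    exact ⟨j, (hv.lt_iff_lt hj hi).1 hlt, rfl⟩
  · rintro ⟨j, hj, rfl⟩
    have hjn : j ≤ n := (le_of_lt hj).trans hi
    exact ⟨⟨j, hjn, rfl⟩, hv hjn hi hj⟩

theorem exists_isLexEnum {t : Set Vertex} {n : ℕ} (hn : t.encard = (n : ℕ∞) + 1) :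
    ∃ v : ℕ → Vertex, IsLexEnum t v := by
  have ht := finite_of_encard hn
  have hcard : ht.toFinset.card = n + 1 := by
    rw [ht.encard_eq_coe_toFinset_card] at hn
    exact_mod_cast hn
  let e := ht.toFinset.orderEmbOfFin hcard
  let v : ℕ → Vertex := fun i => if h : i < n + 1 then e ⟨i, h⟩ else []
  have hv (i : ℕ) (h : i ≤ n) : v i = e ⟨i, Nat.lt_succ_of_le h⟩ := dif_pos _
  have hmono : StrictMonoOn v (Set.Iic n) := by
    intro i hi j hj hij
    rw [hv i hi, hv j hj]
    exact e.strictMono hij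
  have himg : v '' Set.Iic n = t := by
    refine ht.eq_of_subset_of_encard_le' ?_ ?_
    · rintro _ ⟨i, hi, rfl⟩
      rw [hv i hi]
      exact ht.mem_toFinset.1 (Finset.orderEmbOfFin_mem _ hcard _)
    · rw [hn, encard_image_Iic hmono.injOn]
  exact ⟨v, himg ▸ isLexEnum_of_strictMonoOn hmono⟩

theorem IsLexEnum.zero_eq_nil {t : Set Vertex} {n : ℕ} {v : ℕ → Vertex} (hT : IsTree t)
    (hn : t.encard = (n : ℕ∞) + 1) (hv : IsLexEnum t v) : v 0 = [] := by
  by_contra h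
  obtain ⟨j, hj, -⟩ := hv.exists_of_lt hn (Nat.zero_le n) hT.1
    (vertex_lt_iff.2 (Or.inl ⟨⟨_, rfl⟩, Ne.symm h⟩))
  exact Nat.not_lt_zero j hj

theorem phi231_eq_postRank {t : Set Vertex} {n : ℕ} {v : ℕ → Vertex} (hT : IsTree t)
    (hn : t.encard = (n : ℕ∞) + 1) (hv : IsLexEnum t v) {i : ℕ} (hi : 1 ≤ i) (hin : i ≤ n) :
    phi231 t v i = (postRank t (v i) : ℕ∞) := by
  have ht := finite_of_encard hn
  have hlt : {x ∈ t | x < v i}.ncard = i := by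
    rw [(hv i (by rwa [hn, natCast_lt_add_one_iff])).2, Set.InjOn.ncard_image]
    · rw [show {j | j < i} = (Finset.range i : Set ℕ) by ext; simp, Set.ncard_coe_finset,
        Finset.card_range]
    · exact (hv.injOn hn).mono fun j hj => (le_of_lt hj).trans hin
  have hadd := postRank_add_length hT ht (hv.mem hn hin)
  rw [hlt] at hadd
  have hf : (fringe t (v i)).Finite := ht.subset (Set.sep_subset _ _)
  rw [phi231, if_pos ⟨hi, by rwa [hn, natCast_lt_add_one_iff]⟩, ← hf.cast_ncard_eq]
  norm_cast
  omega

/-! ### The permutation of a tree -/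

theorem exists_perm_phi231 {t : Set Vertex} {n : ℕ} {v : ℕ → Vertex} (hT : IsTree t)
    (hn : t.encard = (n : ℕ∞) + 1) (hv : IsLexEnum t v) :
    ∃ π : Equiv.Perm (Fin n), ∀ i : Fin n,
      (((π i : ℕ) + 1 : ℕ) : ℕ∞) = phi231 t v ((i : ℕ) + 1) := by
  have ht := finite_of_encard hn
  have hmem (i : Fin n) : v (i + 1) ∈ t := hv.mem hn i.2
  have hpos (i : Fin n) : 0 < postRank t (v (i + 1)) := postRank_pos ht (hmem i)
  have hroot : postRank t (v 0) ≤ n + 1 := by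
    have : t.ncard = n + 1 := by
      rw [← ht.cast_ncard_eq] at hn
      exact_mod_cast hn
    rw [← this]
    exact Set.ncard_le_ncard (Set.sep_subset _ _) ht
  have hle (i : Fin n) : postRank t (v (i + 1)) < postRank t (v 0) := by
    rw [postRank_lt_iff ht (hv.mem hn (Nat.zero_le n)) (hmem i)
      (hv.lt hn (Nat.succ_pos _) i.2), hv.zero_eq_nil hT hn]
    exact ⟨_, rfl⟩
  let f : Fin n → Fin n := fun i =>
    ⟨postRank t (v (i + 1)) - 1, by have := hpos i; have := hle i; omega⟩
  have hne {i j : Fin n} (hij : i < j) : postRank t (v (i + 1)) ≠ postRank t (v (j + 1)) := by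
    have hlt : v (i + 1) < v (j + 1) := hv.lt hn (Nat.succ_lt_succ hij) j.2
    by_cases hp : v (i + 1) <+: v (j + 1)
    · exact ((postRank_lt_iff ht (hmem i) (hmem j) hlt).2 hp).ne'
    · exact (postRank_lt ht (hmem j) hlt.ne ((postLE_of_lt hlt).2 hp)).ne
  have hf : Function.Injective f := by
    intro i j hij
    have h1 : postRank t (v (i + 1)) - 1 = postRank t (v (j + 1)) - 1 := congrArg Fin.val hij
    have h2 := hpos i
    have h3 := hpos j
    rcases lt_trichotomy i j with h | h | h
    · exact absurd (by omega) (hne h)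
    · exact h
    · exact absurd (by omega) (hne h)
  refine ⟨Equiv.ofBijective f (Finite.injective_iff_bijective.1 hf), fun i => ?_⟩
  rw [phi231_eq_postRank hT hn hv (Nat.succ_pos _) i.2, Equiv.ofBijective_apply]
  have h2 : 0 < postRank t (v (i + 1)) := hpos i
  simp only [f, Nat.succ_eq_add_one]
  norm_cast
  omega

theorem perm_lt_iff_isPrefix {t : Set Vertex} {n : ℕ} {v : ℕ → Vertex} (hT : IsTree t)
    (hn : t.encard = (n : ℕ∞) + 1) (hv : IsLexEnum t v) {π : Equiv.Perm (Fin n)}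
    (hπ : ∀ i : Fin n, (((π i : ℕ) + 1 : ℕ) : ℕ∞) = phi231 t v ((i : ℕ) + 1)) {i j : Fin n}
    (hij : i < j) : π j < π i ↔ v (i + 1) <+: v (j + 1) := by
  have hrank (k : Fin n) : (π k : ℕ) + 1 = postRank t (v (k + 1)) := by
    have := hπ k
    rw [phi231_eq_postRank hT hn hv (Nat.succ_pos _) k.2] at this
    exact_mod_cast this
  rw [← postRank_lt_iff (finite_of_encard hn) (hv.mem hn i.2) (hv.mem hn j.2)
    (hv.lt hn (Nat.succ_lt_succ hij) j.2), ← hrank, ← hrank, Fin.lt_def]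
  omega

theorem containsPat_p231_iff {n : ℕ} {π : Equiv.Perm (Fin n)} :
    ContainsPat π p231 ↔ ∃ i j k : Fin n, i < j ∧ j < k ∧ π k < π i ∧ π i < π j := by
  have h0 : p231 0 = 1 := rfl
  have h1 : p231 1 = 2 := rfl
  have h2 : p231 2 = 0 := rfl
  constructor
  · rintro ⟨f, hf, h⟩
    exact ⟨f 0, f 1, f 2, hf (by decide), hf (by decide),
      (h 2 0).1 (by rw [h0, h2]; decide), (h 0 1).1 (by rw [h0, h1]; decide)⟩
  · rintro ⟨i, j, k, hij, hjk, hki, hij'⟩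
    refine ⟨![i, j, k], ?_, ?_⟩
    · rw [Fin.strictMono_iff_lt_succ]
      intro a
      fin_cases a
      · exact hij
      · exact hjk
    · intro a b
      have := hki.trans hij'
      fin_cases a <;> fin_cases b <;> simp [h0, h1, h2, hki, hij', this, hki.le, hij'.le, this.le]

theorem avoidsPat_of_phi231 {t : Set Vertex} {n : ℕ} {v : ℕ → Vertex} (hT : IsTree t)
    (hn : t.encard = (n : ℕ∞) + 1) (hv : IsLexEnum t v) {π : Equiv.Perm (Fin n)}
    (hπ : ∀ i : Fin n, (((π i : ℕ) + 1 : ℕ) : ℕ∞) = phi231 t v ((i : ℕ) + 1)) :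
    AvoidsPat π p231 := by
  rw [AvoidsPat, containsPat_p231_iff]
  rintro ⟨i, j, k, hij, hjk, hki, hij'⟩
  have h1 := (perm_lt_iff_isPrefix hT hn hv hπ (hij.trans hjk)).1 hki
  have h2 := (perm_lt_iff_isPrefix hT hn hv hπ hjk).1 (hki.trans hij')
  have h3 := (perm_lt_iff_isPrefix hT hn hv hπ hij).not.1 hij'.not_gt
  have hlt : v (i + 1) < v (j + 1) := hv.lt hn (Nat.succ_lt_succ hij) j.2
  rcases isPrefix_or_isPrefix h1 h2 with h | h
  · exact h3 h
  · exact (le_of_isPrefix h).not_gt hlt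

/-! ### Injectivity -/

theorem IsTree.nil_or_exists_parent {t : Set Vertex} (hT : IsTree t) {x : Vertex} (hx : x ∈ t) :
    x = [] ∨ ∃ u c, x = u ++ [c] ∧ u ∈ t := by
  rcases x.eq_nil_or_concat' with rfl | ⟨u, c, rfl⟩
  · exact Or.inl rfl
  · exact Or.inr ⟨u, c, rfl, hT.2.1 _ _ hx⟩

theorem lt_append_singleton (u : Vertex) (c : ℕ) : u < u ++ [c] :=
  vertex_lt_iff.2 (Or.inl ⟨List.prefix_append _ _, by simp⟩)

/-- If the first vertices of two trees agree, the parent of the next vertex of the first tree is an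
ancestor of the parent of the next vertex of the second one. -/
theorem parent_isPrefix {t : Set Vertex} {n : ℕ} {v v' : ℕ → Vertex}
    (hn : t.encard = (n : ℕ∞) + 1) (hv : IsLexEnum t v)
    (hpre : ∀ i j, i < j → j ≤ n → v i <+: v j → v' i <+: v' j)
    {j : ℕ} (hj : j ≤ n) (heq : ∀ i < j, v i = v' i) {u u' : Vertex} {c c' : ℕ}
    (hu : u ∈ t) (hx : v j = u ++ [c]) (hx' : v' j = u' ++ [c']) (hne : v' j ∉ v' '' {i | i < j}) :
    u <+: u' := by
  obtain ⟨k, hk, rfl⟩ := hv.exists_of_lt hn hj hu (hx ▸ lt_append_singleton u c)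
  have h1 : v' k <+: v' j := hpre k j hk hj (hx ▸ List.prefix_append _ _)
  rw [hx', List.prefix_concat_iff, ← hx'] at h1
  rcases h1 with h1 | h1
  · exact absurd ⟨k, hk, h1⟩ hne
  · rwa [heq k hk]

theorem child_index_le {t t' : Set Vertex} {n : ℕ} {v v' : ℕ → Vertex}
    (hn : t.encard = (n : ℕ∞) + 1) (hn' : t'.encard = (n : ℕ∞) + 1) (hT' : IsTree t')
    (hv : IsLexEnum t v) (hv' : IsLexEnum t' v')
    {j : ℕ} (hj : j ≤ n) (heq : ∀ i < j, v i = v' i) {u : Vertex} {c c' : ℕ}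
    (hx : v j = u ++ [c]) (hx' : v' j = u ++ [c']) : c' ≤ c := by
  by_contra! hlt
  have hmem : u ++ [c] ∈ t' := hT'.2.2 u c' c (hx' ▸ hv'.mem hn' hj) hlt.le
  have hleft : IsLeftOf (u ++ [c]) (v' j) :=
    ⟨u, c, c', hlt, List.prefix_rfl, hx' ▸ List.prefix_rfl⟩
  obtain ⟨k, hk, hkx⟩ := hv'.exists_of_lt hn' hj hmem hleft.lt
  have := hv.lt hn hk hj
  rw [heq k hk, hkx, hx] at this
  exact lt_irrefl _ this

theorem eq_of_prefix_iff {t t' : Set Vertex} {n : ℕ} {v v' : ℕ → Vertex}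
    (hn : t.encard = (n : ℕ∞) + 1) (hn' : t'.encard = (n : ℕ∞) + 1) (hT : IsTree t)
    (hT' : IsTree t') (hv : IsLexEnum t v) (hv' : IsLexEnum t' v')
    (hpre : ∀ i j, i < j → j ≤ n → (v i <+: v j ↔ v' i <+: v' j)) : t = t' := by
  have hnot {s : Set Vertex} {w : ℕ → Vertex} (hs : s.encard = (n : ℕ∞) + 1)
      (hw : IsLexEnum s w) {j : ℕ} (hj : j ≤ n) : w j ∉ w '' {i | i < j} := by
    rintro ⟨i, hi, hij⟩
    exact (hw.lt hs hi hj).ne hij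
  have key (j : ℕ) : j ≤ n → v j = v' j := by
    induction j using Nat.strong_induction_on with
    | _ j ih =>
      intro hj
      have heq (i : ℕ) (hi : i < j) : v i = v' i := ih i hi (hi.le.trans hj)
      rcases Nat.eq_zero_or_pos j with rfl | hpos
      · rw [hv.zero_eq_nil hT hn, hv'.zero_eq_nil hT' hn']
      have hne : v j ≠ [] := hv.zero_eq_nil hT hn ▸ (hv.lt hn hpos hj).ne'
      have hne' : v' j ≠ [] := hv'.zero_eq_nil hT' hn' ▸ (hv'.lt hn' hpos hj).ne'
      obtain ⟨u, c, hx, hu⟩ := (hT.nil_or_exists_parent (hv.mem hn hj)).resolve_left hne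
      obtain ⟨u', c', hx', hu'⟩ := (hT'.nil_or_exists_parent (hv'.mem hn' hj)).resolve_left hne'
      have huu : u = u' := prefix_antisymm
        (parent_isPrefix hn hv (fun i j h h' => (hpre i j h h').1) hj heq hu hx hx' (hnot hn' hv' hj))
        (parent_isPrefix hn' hv' (fun i j h h' => (hpre i j h h').2) hj
          (fun i hi => (heq i hi).symm) hu' hx' hx (hnot hn hv hj))
      subst huu
      have hcc : c = c' := le_antisymm
        (child_index_le hn' hn hT hv' hv hj (fun i hi => (heq i hi).symm) hx' hx)
        (child_index_le hn hn' hT' hv hv' hj heq hx hx')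
      rw [hx, hx', hcc]
  rw [← hv.image_eq hn, ← hv'.image_eq hn']
  exact Set.image_congr key

/-! ### The tree of a sequence avoiding `231` -/

/-- The largest index `i < j` with `q j < q i`, or `0` if there is none. -/
def parentIdx (q : ℕ → ℕ) (j : ℕ) : ℕ := Nat.findGreatest (fun i => q j < q i) (j - 1)

theorem parentIdx_lt (q : ℕ → ℕ) {j : ℕ} (hj : 0 < j) : parentIdx q j < j :=
  (Nat.findGreatest_le _).trans_lt (Nat.sub_lt hj one_pos)

theorem le_of_parentIdx_lt {q : ℕ → ℕ} {i j : ℕ} (h : parentIdx q j < i) (hij : i < j) :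
    q i ≤ q j :=
  not_lt.1 (Nat.findGreatest_is_greatest (P := fun i => q j < q i) h (Nat.le_sub_one_of_lt hij))

theorem lt_parentIdx {q : ℕ → ℕ} {j : ℕ} (hj : q j < q 0) : q j < q (parentIdx q j) :=
  Nat.findGreatest_spec (P := fun i => q j < q i) (Nat.zero_le _) hj

/-- The number of indices `0 < k < j` with the same parent as `j`. -/
def siblingIdx (q : ℕ → ℕ) (j : ℕ) : ℕ :=
  Nat.count (fun k => 0 < k ∧ parentIdx q k = parentIdx q j) j

/-- The vertex of index `j` in the tree encoded by `q`. -/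
def vertexOf (q : ℕ → ℕ) (j : ℕ) : Vertex :=
  if _h : 0 < j then vertexOf q (parentIdx q j) ++ [siblingIdx q j] else []
termination_by j
decreasing_by exact parentIdx_lt q _h

theorem vertexOf_zero (q : ℕ → ℕ) : vertexOf q 0 = [] := by
  rw [vertexOf]; rfl

theorem vertexOf_pos (q : ℕ → ℕ) {j : ℕ} (hj : 0 < j) :
    vertexOf q j = vertexOf q (parentIdx q j) ++ [siblingIdx q j] := by
  rw [vertexOf, dif_pos hj]

theorem exists_count_eq {P : ℕ → Prop} [DecidablePred P] {c j : ℕ} (h : c < Nat.count P j) :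
    ∃ k < j, P k ∧ Nat.count P k = c := by
  induction j with
  | zero => simp at h
  | succ j ih =>
    by_cases hc : c < Nat.count P j
    · obtain ⟨k, hk, h⟩ := ih hc
      exact ⟨k, hk.trans (Nat.lt_succ_self j), h⟩
    · rw [Nat.count_succ] at h
      split_ifs at h with hP
      · exact ⟨j, Nat.lt_succ_self j, hP, by omega⟩
      · omega

theorem parentIdx_isPrefix {q : ℕ → ℕ} (j : ℕ) : vertexOf q (parentIdx q j) <+: vertexOf q j := by
  rcases Nat.eq_zero_or_pos j with rfl | hj
  · exact List.prefix_rfl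
  · rw [vertexOf_pos q hj]
    exact List.prefix_append _ _

theorem exists_of_prefix_vertexOf {q : ℕ → ℕ} {j : ℕ} {u : Vertex} (h : u <+: vertexOf q j) :
    ∃ i ≤ j, vertexOf q i = u := by
  induction j using Nat.strong_induction_on with
  | _ j ih =>
    rcases Nat.eq_zero_or_pos j with rfl | hj
    · exact ⟨0, le_rfl, by rw [vertexOf_zero] at h ⊢; exact (List.prefix_nil.1 h).symm⟩
    rw [vertexOf_pos q hj, List.prefix_concat_iff, ← vertexOf_pos q hj] at h
    rcases h with rfl | h
    · exact ⟨j, le_rfl, rfl⟩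
    · obtain ⟨i, hi, h⟩ := ih _ (parentIdx_lt q hj) h
      exact ⟨i, hi.trans (parentIdx_lt q hj).le, h⟩

theorem vertexOf_prefix_parent {q : ℕ → ℕ} {n : ℕ}
    (havoid : ∀ i j k, i < j → j < k → k ≤ n → q k < q i → q j ≤ q i)
    (hinj : Set.InjOn q (Set.Iic n)) {i j : ℕ} (hij : i < j) (hj : j ≤ n) (hq : q j < q i) :
    vertexOf q i <+: vertexOf q (parentIdx q j) := by
  induction j using Nat.strong_induction_on with
  | _ j ih =>
    have hp : parentIdx q j < j := parentIdx_lt q (by omega)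
    rcases lt_trichotomy i (parentIdx q j) with h | h | h
    · have hle := havoid i _ j h hp hj hq
      refine (ih _ hp h (hp.le.trans hj) (lt_of_le_of_ne hle fun he => h.ne' ?_)).trans
        (parentIdx_isPrefix _)
      exact hinj (hp.le.trans hj) (hij.le.trans hj) he
    · rw [h]
    · exact absurd (le_of_parentIdx_lt h hij) hq.not_ge

theorem vertexOf_isLeftOf {q : ℕ → ℕ} {n : ℕ} (h0 : ∀ j, 0 < j → j ≤ n → q j < q 0)
    (hinj : Set.InjOn q (Set.Iic n)) {i j : ℕ} (hij : i < j) (hj : j ≤ n) (hq : q i < q j) :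
    IsLeftOf (vertexOf q i) (vertexOf q j) := by
  induction hm : i + j using Nat.strong_induction_on generalizing i j with
  | _ m ih =>
    have hi0 : 0 < i := by
      rcases Nat.eq_zero_or_pos i with rfl | h
      · exact absurd (h0 j hij hj) hq.not_gt
      · exact h
    have hpi := parentIdx_lt q hi0
    have hpj := parentIdx_lt q (hi0.trans hij)
    have hqi := lt_parentIdx (h0 i hi0 (hij.le.trans hj))
    have hqj := lt_parentIdx (h0 j (hi0.trans hij) hj)
    rcases lt_trichotomy (parentIdx q i) (parentIdx q j) with h | h | h
    · rcases lt_trichotomy i (parentIdx q j) with h' | h' | h'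
      · exact (ih _ (by omega) h' (by omega) (hq.trans hqj) rfl).mono List.prefix_rfl
          (parentIdx_isPrefix j)
      · rw [← h'] at hqj
        omega
      · have := le_of_parentIdx_lt h h'
        omega
    · refine ⟨vertexOf q (parentIdx q i), siblingIdx q i, siblingIdx q j, ?_, ?_, ?_⟩
      · rw [siblingIdx, siblingIdx, h]
        exact Nat.count_strict_mono ⟨hi0, h⟩ hij
      · rw [← vertexOf_pos q hi0]
      · rw [h, ← vertexOf_pos q (hi0.trans hij)]
    · have hle := le_of_parentIdx_lt h (hpi.trans hij)
      have hne : q (parentIdx q i) ≠ q j := fun he =>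
        (hpi.trans hij).ne (hinj ((hpi.trans hij).le.trans hj) hj he)
      exact (ih _ (by omega) (hpi.trans hij) hj (lt_of_le_of_ne hle hne) rfl).mono
        (parentIdx_isPrefix i) List.prefix_rfl

theorem strictMonoOn_vertexOf {q : ℕ → ℕ} {n : ℕ} (h0 : ∀ j, 0 < j → j ≤ n → q j < q 0)
    (havoid : ∀ i j k, i < j → j < k → k ≤ n → q k < q i → q j ≤ q i)
    (hinj : Set.InjOn q (Set.Iic n)) : StrictMonoOn (vertexOf q) (Set.Iic n) := by
  intro i hi j hj hij
  rcases lt_trichotomy (q i) (q j) with h | h | h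
  · exact (vertexOf_isLeftOf h0 hinj hij hj h).lt
  · exact absurd (hinj hi hj h) hij.ne
  · have hpre := vertexOf_prefix_parent havoid hinj hij hj h
    refine (le_of_isPrefix hpre).trans_lt ?_
    rw [vertexOf_pos q (Nat.zero_lt_of_lt hij)]
    exact lt_append_singleton _ _

theorem vertexOf_prefix_iff {q : ℕ → ℕ} {n : ℕ} (h0 : ∀ j, 0 < j → j ≤ n → q j < q 0)
    (havoid : ∀ i j k, i < j → j < k → k ≤ n → q k < q i → q j ≤ q i)
    (hinj : Set.InjOn q (Set.Iic n)) {i j : ℕ} (hij : i < j) (hj : j ≤ n) :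
    vertexOf q i <+: vertexOf q j ↔ q j < q i := by
  refine ⟨fun h => ?_, fun h =>
    (vertexOf_prefix_parent havoid hinj hij hj h).trans (parentIdx_isPrefix j)⟩
  by_contra! hle
  have hne : q i ≠ q j := fun he => hij.ne (hinj (hij.le.trans hj) hj he)
  exact (vertexOf_isLeftOf h0 hinj hij hj (lt_of_le_of_ne hle hne)).not_isPrefix h

theorem isTree_vertexOf (q : ℕ → ℕ) (n : ℕ) : IsTree (vertexOf q '' Set.Iic n) := by
  refine ⟨⟨0, Nat.zero_le n, vertexOf_zero q⟩, ?_, ?_⟩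
  · rintro u v ⟨j, hj, huv⟩
    obtain ⟨i, hi, rfl⟩ := exists_of_prefix_vertexOf (huv ▸ List.prefix_append u v)
    exact ⟨i, hi.trans hj, rfl⟩
  · rintro u c c' ⟨j, hj, hu⟩ hc
    rcases Nat.eq_zero_or_pos j with rfl | hj0
    · simp [vertexOf_zero] at hu
    rcases hc.eq_or_lt with rfl | hc
    · exact ⟨j, hj, hu⟩
    rw [vertexOf_pos q hj0] at hu
    obtain ⟨rfl, hsib⟩ := List.append_inj' hu rfl
    obtain rfl : siblingIdx q j = c := by simpa using hsib
    obtain ⟨k, hk, ⟨hk0, hpar⟩, hcount⟩ := exists_count_eq hc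
    refine ⟨k, hk.le.trans hj, ?_⟩
    rw [vertexOf_pos q hk0, hpar, siblingIdx, hpar, hcount]

theorem perm_eq_of_lt_iff {n : ℕ} {π σ : Equiv.Perm (Fin n)}
    (h : ∀ i j, i < j → (π j < π i ↔ σ j < σ i)) : π = σ := by
  have hmono : StrictMono (π.symm.trans σ) := by
    intro a b hab
    obtain ⟨i, rfl⟩ := π.surjective a
    obtain ⟨j, rfl⟩ := π.surjective b
    simp only [Equiv.trans_apply, Equiv.symm_apply_apply]
    rcases lt_trichotomy i j with hij | rfl | hij
    · refine lt_of_le_of_ne (not_lt.1 fun hlt => ?_) fun he => hij.ne (σ.injective he)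
      exact hab.not_gt ((h i j hij).2 hlt)
    · exact absurd hab (lt_irrefl _)
    · exact (h j i hij).1 hab
  let e : Fin n ≃o Fin n := hmono.orderIsoOfSurjective _ (Equiv.surjective _)
  ext i
  have : e (π i) = π i := congrArg (fun f : Fin n ≃o Fin n => f (π i))
    (Subsingleton.elim e (OrderIso.refl _))
  have h2 : σ i = π i := by simpa [e] using this
  rw [h2]

/-- The values of `π`, preceded by a larger entry. -/
def oneLine {n : ℕ} (π : Equiv.Perm (Fin n)) (j : ℕ) : ℕ :=
  if h : 0 < j ∧ j ≤ n then π ⟨j - 1, by omega⟩ else n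

theorem oneLine_zero {n : ℕ} (π : Equiv.Perm (Fin n)) : oneLine π 0 = n := rfl

theorem oneLine_succ {n : ℕ} (π : Equiv.Perm (Fin n)) (i : Fin n) :
    oneLine π (i + 1) = π i :=
  dif_pos ⟨Nat.succ_pos _, i.2⟩

theorem exists_fin_eq_succ {n j : ℕ} (hj : 0 < j) (hjn : j ≤ n) : ∃ i : Fin n, j = i + 1 :=
  ⟨⟨j - 1, by omega⟩, (Nat.sub_add_cancel hj).symm⟩

theorem oneLine_lt {n : ℕ} (π : Equiv.Perm (Fin n)) {j : ℕ} (hj : 0 < j) (hjn : j ≤ n) :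
    oneLine π j < oneLine π 0 := by
  obtain ⟨i, rfl⟩ := exists_fin_eq_succ hj hjn
  rw [oneLine_succ, oneLine_zero]
  exact (π i).2

theorem injOn_oneLine {n : ℕ} (π : Equiv.Perm (Fin n)) : Set.InjOn (oneLine π) (Set.Iic n) := by
  intro i hi j hj hij
  rcases Nat.eq_zero_or_pos i with rfl | hi0 <;> rcases Nat.eq_zero_or_pos j with rfl | hj0
  · rfl
  · exact absurd hij (oneLine_lt π hj0 hj).ne'
  · exact absurd hij (oneLine_lt π hi0 hi).ne
  · obtain ⟨i, rfl⟩ := exists_fin_eq_succ hi0 hi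
    obtain ⟨j, rfl⟩ := exists_fin_eq_succ hj0 hj
    rw [oneLine_succ, oneLine_succ, Fin.val_inj, π.injective.eq_iff] at hij
    rw [hij]

theorem oneLine_avoids {n : ℕ} {π : Equiv.Perm (Fin n)} (hπ : AvoidsPat π p231) (i j k : ℕ)
    (hij : i < j) (hjk : j < k) (hk : k ≤ n) (hki : oneLine π k < oneLine π i) :
    oneLine π j ≤ oneLine π i := by
  rcases Nat.eq_zero_or_pos i with rfl | hi0
  · exact (oneLine_lt π hij (hjk.le.trans hk)).le
  obtain ⟨a, rfl⟩ := exists_fin_eq_succ hi0 ((hij.trans hjk).le.trans hk)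
  obtain ⟨b, rfl⟩ := exists_fin_eq_succ (hi0.trans hij) (hjk.le.trans hk)
  obtain ⟨c, rfl⟩ := exists_fin_eq_succ (hi0.trans (hij.trans hjk)) hk
  simp only [oneLine_succ] at hki ⊢
  by_contra! hlt
  exact hπ (containsPat_p231_iff.2
    ⟨a, b, c, Nat.lt_of_succ_lt_succ hij, Nat.lt_of_succ_lt_succ hjk, hki, hlt⟩)

/-- The map `t ↦ Φ_t^{231}`, `Φ_t^{231}(i) = i + |t_{v_i}| - |v_i|`
(where `v_0, …, v_n` list the vertices of `t` in increasing lexicographic order),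
is a bijection from trees with `n+1` vertices onto `Av_n(231)`. -/
theorem bijection_231 (n : ℕ) :
    (∀ t : TreeN n, ∃ v : ℕ → Vertex, IsLexEnum t.1 v) ∧
    (∀ t : TreeN n, ∀ v : ℕ → Vertex, IsLexEnum t.1 v →
      ∃! π : Equiv.Perm (Fin n), ∀ i : Fin n,
        (((π i : ℕ) + 1 : ℕ) : ℕ∞) = phi231 t.1 v ((i : ℕ) + 1)) ∧
    (∀ Φ : TreeN n → Equiv.Perm (Fin n),
      (∀ t : TreeN n, ∀ v : ℕ → Vertex, IsLexEnum t.1 v → ∀ i : Fin n,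
        (((Φ t i : ℕ) + 1 : ℕ) : ℕ∞) = phi231 t.1 v ((i : ℕ) + 1)) →
      Set.BijOn Φ Set.univ {π : Equiv.Perm (Fin n) | AvoidsPat π p231}) := by
  refine ⟨fun t => exists_isLexEnum t.2.2, fun t v hv => ?_, fun Φ hΦ => ⟨?_, ?_, ?_⟩⟩
  · obtain ⟨π, hπ⟩ := exists_perm_phi231 t.2.1 t.2.2 hv
    refine ⟨π, hπ, fun σ hσ => Equiv.ext fun i => Fin.ext ?_⟩
    have := (hσ i).trans (hπ i).symm
    norm_cast at this
    omega
  · intro t _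
    obtain ⟨v, hv⟩ := exists_isLexEnum t.2.2
    exact avoidsPat_of_phi231 t.2.1 t.2.2 hv (hΦ t v hv)
  · intro t _ t' _ htt
    obtain ⟨v, hv⟩ := exists_isLexEnum t.2.2
    obtain ⟨v', hv'⟩ := exists_isLexEnum t'.2.2
    refine Subtype.ext (eq_of_prefix_iff t.2.2 t'.2.2 t.2.1 t'.2.1 hv hv' fun i j hij hj => ?_)
    rcases Nat.eq_zero_or_pos i with rfl | hi
    · rw [hv.zero_eq_nil t.2.1 t.2.2, hv'.zero_eq_nil t'.2.1 t'.2.2]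
      exact iff_of_true ⟨_, rfl⟩ ⟨_, rfl⟩
    obtain ⟨a, rfl⟩ := exists_fin_eq_succ hi (hij.le.trans hj)
    obtain ⟨b, rfl⟩ := exists_fin_eq_succ (hi.trans hij) hj
    have hab : a < b := Nat.lt_of_succ_lt_succ hij
    rw [← perm_lt_iff_isPrefix t.2.1 t.2.2 hv (hΦ t v hv) hab,
      ← perm_lt_iff_isPrefix t'.2.1 t'.2.2 hv' (hΦ t' v' hv') hab, htt]
  · intro π hπ
    have h0 (j : ℕ) (hj : 0 < j) (hjn : j ≤ n) := oneLine_lt π hj hjn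
    have hmono := strictMonoOn_vertexOf h0 (oneLine_avoids hπ) (injOn_oneLine π)
    let t : TreeN n := ⟨vertexOf (oneLine π) '' Set.Iic n, isTree_vertexOf _ n,
      encard_image_Iic hmono.injOn⟩
    have hv : IsLexEnum t.1 (vertexOf (oneLine π)) := isLexEnum_of_strictMonoOn hmono
    refine ⟨t, Set.mem_univ t, perm_eq_of_lt_iff fun i j hij => ?_⟩
    rw [perm_lt_iff_isPrefix t.2.1 t.2.2 hv (hΦ t _ hv) hij,
      vertexOf_prefix_iff h0 (oneLine_avoids hπ) (injOn_oneLine π) (Nat.succ_lt_succ hij) j.2,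
      oneLine_succ, oneLine_succ, Fin.lt_def]

end AvoidPaper
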